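/- (Existence of the potential ω on a simply connected domain.) Let D ⊆ ℂ be open and simply connected, let u : ℂ → ℂ be continuous on D, and let ψ, ψ⁺ : ℂ → ℂ be of class C¹ on D with ∂_z̄ ψ = u·conj(ψ) and ∂_z̄ ψ⁺ = −conj(u)·conj(ψ⁺) on D. Then there exists a function ω : D → ℂ, real-differentiable on D, such that ∂_z ω = ψ·ψ⁺ and ∂_z̄ ω = −conj(ψ·ψ⁺) on D, and ω takes purely imaginary values on D. -/

import Mathlib

open Complex

/-- The Wirtinger derivative ∂_z̄ f(z) = (1/2)((fderiv ℝ f z) 1 + i·((fderiv ℝ f z) i)). -/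
noncomputable def dzbar (f : ℂ → ℂ) (z : ℂ) : ℂ :=
  (1 / 2 : ℂ) * ((fderiv ℝ f z) 1 + Complex.I * (fderiv ℝ f z) Complex.I)

/-- The Wirtinger derivative ∂_z f(z) = (1/2)((fderiv ℝ f z) 1 − i·((fderiv ℝ f z) i)). -/
noncomputable def dz (f : ℂ → ℂ) (z : ℂ) : ℂ :=
  (1 / 2 : ℂ) * ((fderiv ℝ f z) 1 - Complex.I * (fderiv ℝ f z) Complex.I)

section Aux

open Topology Filter

/-- The real numbers with the discrete topology, used as the fibre of a covering space. -/
@[ext] structure DiscR : Type where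
  /-- the underlying real number -/
  val : ℝ

instance : TopologicalSpace DiscR := ⊥
instance : DiscreteTopology DiscR := ⟨rfl⟩

/-- The covering space of germs of primitives. -/
noncomputable def germCore {X : Type} [TopologicalSpace X] (B : X → Set X)
    (hB : ∀ x, IsOpen (B x)) (hxB : ∀ x, x ∈ B x) (F : X → X → ℝ)
    (hF : ∀ i j x, x ∈ B i → x ∈ B j → ∀ᶠ y in 𝓝 x, F i y - F j y = F i x - F j x) :
    FiberBundleCore X X DiscR where
  baseSet := B
  isOpen_baseSet := hB
  indexAt := id
  mem_baseSet_at := hxB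
  coordChange i j x v := ⟨v.val + (F i x - F j x)⟩
  coordChange_self i x _ v := by
    ext
    simp
  continuousOn_coordChange i j := by
    rintro ⟨x, v⟩ ⟨⟨h1, h2⟩, -⟩
    apply ContinuousAt.continuousWithinAt
    have hev : ∀ᶠ p : X × DiscR in 𝓝 (x, v),
        (⟨v.val + (F i x - F j x)⟩ : DiscR) = ⟨p.2.val + (F i p.1 - F j p.1)⟩ := by
      rw [nhds_prod_eq, nhds_discrete DiscR]
      filter_upwards [(hF i j x h1 h2).prod_mk (show ∀ᶠ w in pure v, w = v from rfl)] with p hp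
      rw [hp.1, hp.2]
    exact (continuousAt_const (y := (⟨v.val + (F i x - F j x)⟩ : DiscR))).congr hev
  coordChange_comp i j k x _ v := by
    ext
    show (v.val + (F i x - F j x)) + (F j x - F k x) = v.val + (F i x - F k x)
    ring

/-- Locally defined functions with locally constant differences glue, up to locally constant
functions, on a simply connected space. -/
theorem exists_glue {X : Type} [TopologicalSpace X] [SimplyConnectedSpace X]
    [LocallyPathConnectedSpace X] (B : X → Set X)
    (hB : ∀ x, IsOpen (B x)) (hxB : ∀ x, x ∈ B x) (F : X → X → ℝ)
    (hF : ∀ i j x, x ∈ B i → x ∈ B j → ∀ᶠ y in 𝓝 x, F i y - F j y = F i x - F j x) :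
    ∃ h : X → ℝ, ∀ x, ∀ᶠ y in 𝓝 x, h y - F x y = h x - F x x := by
  let Z := germCore B hB hxB F hF
  have cov : IsCoveringMap (Bundle.TotalSpace.proj : Bundle.TotalSpace DiscR Z.Fiber → X) :=
    FiberBundle.isCoveringMap
  obtain ⟨x₀⟩ : Nonempty X := inferInstance
  obtain ⟨s, ⟨-, hs⟩, -⟩ := cov.existsUnique_continuousMap_lifts (ContinuousMap.id X) x₀
    (⟨x₀, (⟨0⟩ : DiscR)⟩ : Bundle.TotalSpace DiscR Z.Fiber) rfl
  have hs' : ∀ x, (s x).proj = x := fun x => congrFun hs x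
  let c : X → ℝ := fun x => DiscR.val (s x).snd
  refine ⟨fun x => c x + F x x, fun x => ?_⟩
  have h1 : ContinuousAt (fun y => ((Z.localTrivAt x) (s y)).2) x :=
    ((FiberBundle.continuousAt_totalSpace DiscR s).1 s.continuous.continuousAt).2 |> fun h => by
      rw [hs' x] at h
      exact h
  have h2 : ∀ y, ((Z.localTrivAt x) (s y)).2 = ⟨c y + (F y y - F x y)⟩ := by
    intro y
    have : ((Z.localTrivAt x) (s y)).2 =
      ⟨c y + (F (s y).proj (s y).proj - F x (s y).proj)⟩ := rfl
    rw [this, hs' y]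
  have h3 : ∀ᶠ y in 𝓝 x, ((Z.localTrivAt x) (s y)).2 = ((Z.localTrivAt x) (s x)).2 := by
    have := h1.eventually (show ∀ᶠ w in 𝓝 _, w = _ by rw [nhds_discrete]; exact rfl)
    exact this
  filter_upwards [h3] with y hy
  rw [h2, h2] at hy
  have hy' : c y + (F y y - F x y) = c x + (F x x - F x x) := congrArg DiscR.val hy
  linarith

/-- A closed one-form on a simply connected plane domain is exact. -/
theorem exists_primitive (D : Set ℂ) (hD : IsOpen D) (hsc : SimplyConnectedSpace D)
    (η : ℂ → ℂ →L[ℝ] ℝ) (hη : DifferentiableOn ℝ η D)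
    (hsym : ∀ a ∈ D, ∀ x y, fderiv ℝ η a x y = fderiv ℝ η a y x) :
    ∃ h : ℂ → ℝ, ∀ z ∈ D, HasFDerivAt h (η z) z := by
  have hloc : ∀ x : D, ∃ r > 0, Metric.ball (x : ℂ) r ⊆ D ∧
      ∃ f : ℂ → ℝ, ∀ a ∈ Metric.ball (x : ℂ) r, HasFDerivAt f (η a) a := by
    intro x
    obtain ⟨r, hr, hsub⟩ := Metric.isOpen_iff.1 hD x x.2
    exact ⟨r, hr, hsub, (convex_ball _ _).exists_forall_hasFDerivAt_of_fderiv_symmetric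
      Metric.isOpen_ball (hη.mono hsub) fun a ha => hsym a (hsub ha)⟩
  choose r hr hsub f hf using hloc
  have := hD.locallyPathConnectedSpace
  obtain ⟨h, hh⟩ := exists_glue (X := D) (fun x => (↑) ⁻¹' Metric.ball (x : ℂ) (r x))
    (fun x => Metric.isOpen_ball.preimage continuous_subtype_val)
    (fun x => Metric.mem_ball_self (hr x)) (fun i y => f i y) (by
      intro i j x hi hj
      have hconv : Convex ℝ (Metric.ball (i : ℂ) (r i) ∩ Metric.ball (j : ℂ) (r j)) :=
        (convex_ball _ _).inter (convex_ball _ _)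
      have hop : IsOpen (Metric.ball (i : ℂ) (r i) ∩ Metric.ball (j : ℂ) (r j)) :=
        Metric.isOpen_ball.inter Metric.isOpen_ball
      have hd : ∀ y ∈ Metric.ball (i : ℂ) (r i) ∩ Metric.ball (j : ℂ) (r j),
          HasFDerivAt (fun y => f i y - f j y) (0 : ℂ →L[ℝ] ℝ) y := by
        intro y hy
        have := (hf i y hy.1).sub (hf j y hy.2)
        rwa [sub_self] at this
      filter_upwards [(hop.preimage continuous_subtype_val).mem_nhds
        (show x ∈ ((↑) : D → ℂ) ⁻¹' _ from ⟨hi, hj⟩)] with y hy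
      exact hop.is_const_of_fderiv_eq_zero (𝕜 := ℝ) (f := fun y => f i y - f j y)
        hconv.isPreconnected
        (fun z hz => (hd z hz).differentiableAt.differentiableWithinAt)
        (fun z hz => (hd z hz).fderiv) hy ⟨hi, hj⟩)
  classical
  refine ⟨fun z => if hz : z ∈ D then h ⟨z, hz⟩ else 0, fun z hz => ?_⟩
  have h1 := hh ⟨z, hz⟩
  rw [nhds_subtype_eq_comap, eventually_comap] at h1
  refine ((hf ⟨z, hz⟩ z (Metric.mem_ball_self (hr _))).add_const
    (h ⟨z, hz⟩ - f ⟨z, hz⟩ z)).congr_of_eventuallyEq ?_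
  filter_upwards [h1, hD.mem_nhds hz] with y hy hyD
  have := hy ⟨y, hyD⟩ rfl
  simp only [dif_pos hyD]
  linarith

end Aux

/-- on a simply connected open D, given C¹ solutions ψ, ψ⁺ of the
conjugate pair of equations with continuous u, there exists a purely imaginary
potential ω with ∂_z ω = ψ·ψ⁺ and ∂_z̄ ω = −conj(ψ·ψ⁺) on D. -/
theorem statement14 (D : Set ℂ) (hD : IsOpen D) (hsc : SimplyConnectedSpace D)
    (u ψ ψp : ℂ → ℂ)
    (hu : ContinuousOn u D)
    (hψ : ContDiffOn ℝ 1 ψ D) (hψp : ContDiffOn ℝ 1 ψp D)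
    (heq1 : ∀ z ∈ D, dzbar ψ z = u z * (starRingEnd ℂ) (ψ z))
    (heq2 : ∀ z ∈ D, dzbar ψp z = -(starRingEnd ℂ) (u z) * (starRingEnd ℂ) (ψp z)) :
    ∃ ω : ℂ → ℂ,
      (∀ z ∈ D, DifferentiableAt ℝ ω z) ∧
      (∀ z ∈ D, dz ω z = ψ z * ψp z) ∧
      (∀ z ∈ D, dzbar ω z = -(starRingEnd ℂ) (ψ z * ψp z)) ∧
      (∀ z ∈ D, (ω z).re = 0) := by
  have hdψ : ∀ z ∈ D, HasFDerivAt ψ (fderiv ℝ ψ z) z := fun z hz =>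
    ((hψ.differentiableOn one_ne_zero).differentiableAt (hD.mem_nhds hz)).hasFDerivAt
  have hdψp : ∀ z ∈ D, HasFDerivAt ψp (fderiv ℝ ψp z) z := fun z hz =>
    ((hψp.differentiableOn one_ne_zero).differentiableAt (hD.mem_nhds hz)).hasFDerivAt
  -- the real one-form `v ↦ 2 Im (ψ ψ⁺ v)`, as a linear function of the coefficient
  let L : ℂ →L[ℝ] ℂ →L[ℝ] ℝ :=
    (ContinuousLinearMap.compL ℝ ℂ ℂ ℝ ((2 : ℝ) • Complex.imCLM)).comp
      (ContinuousLinearMap.mul ℝ ℂ)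
  have hL : ∀ a b : ℂ, L a b = 2 * (a * b).im := fun a b => by simp [L]
  have hη : ∀ z ∈ D, HasFDerivAt (fun z => L (ψ z * ψp z))
      (L.comp (ψ z • fderiv ℝ ψp z + ψp z • fderiv ℝ ψ z)) z := fun z hz =>
    L.hasFDerivAt.comp z ((hdψ z hz).mul (hdψp z hz))
  obtain ⟨h, hh⟩ := exists_primitive D hD hsc (fun z => L (ψ z * ψp z))
    (fun z hz => (hη z hz).differentiableAt.differentiableWithinAt) (by
      intro z hz x y
      rw [(hη z hz).fderiv]
      have e1 := heq1 z hz
      have e2 := heq2 z hz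
      have lin : ∀ (A : ℂ →L[ℝ] ℂ) (v : ℂ), A v = v.re * A 1 + v.im * A I := by
        intro A v
        conv_lhs => rw [show v = v.re • (1 : ℂ) + v.im • I by simp [Complex.re_add_im]]
        rw [map_add, map_smul, map_smul]; simp
      simp only [dzbar] at e1 e2
      simp only [ContinuousLinearMap.comp_apply, hL, add_apply,
        smul_apply, smul_eq_mul]
      rw [lin _ x, lin _ y, lin (fderiv ℝ ψ z) x, lin (fderiv ℝ ψ z) y]
      generalize fderiv ℝ ψ z 1 = a at *
      generalize fderiv ℝ ψ z I = b at *
      generalize fderiv ℝ ψp z 1 = c at *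
      generalize fderiv ℝ ψp z I = d at *
      generalize ψ z = p at *
      generalize ψp z = q at *
      generalize u z = w at *
      have key : ((a + I * b) * q + p * (c + I * d)).re = 0 := by
        have e1' : a + I * b = 2 * (w * (starRingEnd ℂ) p) := by rw [← e1]; ring
        have e2' : c + I * d = 2 * (-(starRingEnd ℂ) w * (starRingEnd ℂ) q) := by rw [← e2]; ring
        rw [e1', e2']
        simp
        ring
      simp at key ⊢
      linear_combination (x.re * y.im - x.im * y.re) * key)
  have hω : ∀ z ∈ D, HasFDerivAt (fun z => I * ((h z : ℝ) : ℂ))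
      (I • (Complex.ofRealCLM.comp (L (ψ z * ψp z)))) z := fun z hz =>
    (Complex.ofRealCLM.hasFDerivAt.comp z (hh z hz)).const_mul I
  refine ⟨fun z => I * ((h z : ℝ) : ℂ), fun z hz => (hω z hz).differentiableAt, ?_, ?_, ?_⟩
  · intro z hz
    rw [dz, (hω z hz).fderiv]
    generalize hg : ψ z * ψp z = g
    apply Complex.ext <;> simp [hL]
  · intro z hz
    rw [dzbar, (hω z hz).fderiv]
    generalize hg : ψ z * ψp z = g
    apply Complex.ext <;> simp [hL]
  · intro z hz
    simp
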